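/- Let k be a local field, K an algebraic closure of k, and let M ⊆ K^n be the common zero set of a family of polynomials in K[x₁,…,x_n] (an affine subvariety of A_K^n). If for every intermediate field k ⊆ k' ⊆ K that is finite-dimensional over k the set M(k') := M ∩ (k')^n is countable, then M is finite. -/

import Mathlib

section

open MvPolynomial

theorem exists_eval_surjOn_of_infinite {K : Type*} [Field K] [IsAlgClosed K] {n : ℕ}
    {I : Ideal (MvPolynomial (Fin n) K)}
    (hI : {x : Fin n → K | ∀ p ∈ I, eval x p = 0}.Infinite) :
    ∃ G : MvPolynomial (Fin n) K,
      Set.SurjOn (fun x => eval x G) {x : Fin n → K | ∀ p ∈ I, eval x p = 0} Set.univ := by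
  have hne : I ≠ ⊤ := by
    rintro rfl
    obtain ⟨x, hx⟩ := hI.nonempty
    simpa using hx 1 trivial
  obtain ⟨s, -, g, hinj, hint⟩ := exists_integral_inj_algHom_of_quotient I hne
  rcases Nat.eq_zero_or_pos s with rfl | hs
  · refine absurd ?_ hI
    have hroot : ∀ j : Fin n, ∃ p : Polynomial K, p.Monic ∧
        Polynomial.aeval (X j : MvPolynomial (Fin n) K) p ∈ I := by
      intro j
      obtain ⟨p, hp, hp0⟩ := hint (Ideal.Quotient.mk I (X j))
      refine ⟨p.map (isEmptyAlgEquiv K (Fin 0)).toRingHom, hp.map _, ?_⟩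
      rw [← Ideal.Quotient.eq_zero_iff_mem, ← hp0, ← Ideal.Quotient.mkₐ_eq_mk K,
        ← Polynomial.aeval_algHom_apply, Polynomial.aeval_def, Polynomial.eval₂_map]
      congr 1
      ext x
      · exact ((Ideal.Quotient.mkₐ K I).comp (Algebra.ofId K _)).commutes _ |>.trans <|
          (congrArg (algebraMap K _) ((isEmptyAlgEquiv K (Fin 0)).commutes x)).trans
          (g.commutes x).symm
      · exact x.elim0
    choose p hp hpI using hroot
    refine (Set.Finite.pi' fun j => (p j).rootSet_finite K).subset ?_
    intro x hx j
    rw [Polynomial.mem_rootSet]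
    refine ⟨(hp j).ne_zero, ?_⟩
    have h := hx _ (hpI j)
    rw [← coe_aeval_eq_eval, RingHom.coe_coe, ← Polynomial.aeval_algHom_apply] at h
    simpa using h
  · obtain ⟨G, hG⟩ := Ideal.Quotient.mk_surjective (g (X ⟨0, hs⟩))
    refine ⟨G, fun t _ => ?_⟩
    algebraize [g.toRingHom]
    have : FaithfulSMul (MvPolynomial (Fin s) K) (MvPolynomial (Fin n) K ⧸ I) :=
      (faithfulSMul_iff_algebraMap_injective _ _).2 hinj
    have hmax : (vanishingIdeal K {fun _ : Fin s => t}).IsMaximal := inferInstance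
    obtain ⟨P, hP, hPc⟩ := Ideal.exists_ideal_over_maximal_of_isIntegral
      (S := MvPolynomial (Fin n) K ⧸ I) (vanishingIdeal K {fun _ : Fin s => t}) (by
        exact ((RingHom.injective_iff_ker_eq_bot g.toRingHom).1 hinj).trans_le bot_le)
    have hmax' : (P.comap (Ideal.Quotient.mk I)).IsMaximal :=
      Ideal.comap_isMaximal_of_surjective _ Ideal.Quotient.mk_surjective
    obtain ⟨x, hx⟩ := isMaximal_iff_eq_vanishingIdeal_singleton.1 hmax'
    have hmem : ∀ q, Ideal.Quotient.mk I q ∈ P ↔ eval x q = 0 := by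
      intro q
      rw [← Ideal.mem_comap, hx, mem_vanishingIdeal_singleton_iff, ← coe_aeval_eq_eval,
        RingHom.coe_coe]
    refine ⟨x, fun q hq => ?_, ?_⟩
    · rw [← hmem, Ideal.Quotient.eq_zero_iff_mem.2 hq]
      exact P.zero_mem
    · have h1 : (X ⟨0, hs⟩ - C t : MvPolynomial (Fin s) K) ∈
          vanishingIdeal K {fun _ : Fin s => t} := by
        rw [mem_vanishingIdeal_singleton_iff]; simp
      rw [← hPc, Ideal.mem_comap] at h1
      have h2 : algebraMap (MvPolynomial (Fin s) K) (MvPolynomial (Fin n) K ⧸ I)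
          (X ⟨0, hs⟩ - C t) = Ideal.Quotient.mk I (G - C t) := by
        rw [map_sub, map_sub, hG]
        congr 1
        exact g.commutes t
      rw [h2, hmem] at h1
      simpa [sub_eq_zero] using h1

end

open Polynomial Topology in
theorem Polynomial.exists_root_mem_nhds_of_dense {k L : Type*} [NontriviallyNormedField k]
    [CompleteSpace k] [NormedCommRing L] [NormedAlgebra k L] [CompleteSpace L]
    {D : Set k} (hD : Dense D) {d : ℕ} {c : Fin d → k} {x : L}
    (hroot : aeval x (X ^ d + ∑ i, C (c i) * X ^ (i : ℕ)) = 0)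
    (hunit : IsUnit (aeval x (derivative (X ^ d + ∑ i, C (c i) * X ^ (i : ℕ)))))
    {U : Set L} (hU : U ∈ 𝓝 x) :
    ∃ y ∈ U, ∃ e : Fin d → k, (∀ i, e i ∈ D) ∧
      aeval y (X ^ d + ∑ i, C (e i) * X ^ (i : ℕ)) = 0 := by
  have hfst : HasStrictFDerivAt (𝕜 := k) (Prod.fst : (Fin d → k) × L → _) _ (c, x) :=
    hasStrictFDerivAt_fst
  have hsnd : HasStrictFDerivAt (𝕜 := k) (Prod.snd : (Fin d → k) × L → L) _ (c, x) :=
    hasStrictFDerivAt_snd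
  have hF := (HasStrictFDerivAt.pow hsnd d).fun_add (HasStrictFDerivAt.fun_sum (u := Finset.univ) fun i _ =>
    (((ContinuousLinearMap.proj (R := k) (φ := fun _ : Fin d => k) i).hasStrictFDerivAt.comp
      (c, x) hfst).fun_smul
      (HasStrictFDerivAt.pow hsnd (i : ℕ))))
  have hG := hfst.prodMk hF
  have hmap := hG.map_nhds_eq_of_surj ?_
  · have h1 := Filter.image_mem_map (m := fun p : (Fin d → k) × L =>
      (p.1, p.2 ^ d + ∑ i, p.1 i • p.2 ^ (i : ℕ))) (prod_mem_nhds (Filter.univ_mem (f := 𝓝 c)) hU)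
    have h0 : x ^ d + ∑ i, c i • x ^ (i : ℕ) = 0 := by
      simpa [Algebra.smul_def] using hroot
    erw [hmap] at h1
    simp only [ContinuousLinearMap.proj_apply, h0] at h1
    obtain ⟨V, hV, W, hW, hVW⟩ := mem_nhds_prod_iff.1 h1
    have hDd : Dense (Set.univ.pi fun _ : Fin d => D) := dense_pi _ fun _ _ => hD
    obtain ⟨e, heV, heD⟩ := mem_closure_iff_nhds.1 (hDd c) V hV
    obtain ⟨⟨e', y⟩, ⟨-, hy⟩, hey⟩ := hVW (Set.mk_mem_prod heV (mem_of_mem_nhds hW))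
    simp only [Prod.mk.injEq] at hey
    obtain ⟨rfl, hey⟩ := hey
    refine ⟨y, hy, e', fun i => heD i trivial, ?_⟩
    simpa [Algebra.smul_def] using hey
  · rw [LinearMap.range_eq_top]
    rintro ⟨a, b⟩
    obtain ⟨u, hu⟩ := hunit
    have key : ∀ v : L, (d • x ^ (d - 1)) * v + ∑ i : Fin d, c i • ((i : ℕ) • x ^ ((i : ℕ) - 1) * v)
        = u * v := by
      intro v
      rw [hu]
      simp [Algebra.smul_def, Finset.sum_mul, add_mul, derivative_pow, mul_assoc]
    refine ⟨(a, ↑u⁻¹ * (b - ∑ i, a i • x ^ (i : ℕ))), ?_⟩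
    have := key (↑u⁻¹ * (b - ∑ i, a i • x ^ (i : ℕ)))
    rw [Units.mul_inv_cancel_left] at this
    simp [Finset.sum_add_distrib] at this ⊢
    rw [← add_assoc, this, sub_add_cancel]

open IntermediateField in
theorem IntermediateField.adjoin_simple_eq_top_of_linearIndependent {k L : Type*} [Field k]
    [Field L] [Algebra k L] [FiniteDimensional k L] {y : L}
    (hy : LinearIndependent k fun i : Fin (Module.finrank k L) => y ^ (i : ℕ)) : k⟮y⟯ = ⊤ := by
  have : Nonempty (Fin (Module.finrank k L)) := ⟨⟨0, Module.finrank_pos⟩⟩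
  have hspan := hy.span_eq_top_of_card_eq_finrank (Fintype.card_fin _)
  rw [← top_le_iff]
  intro z _
  have hz : z ∈ Submodule.span k (Set.range fun i : Fin (Module.finrank k L) => y ^ (i : ℕ)) :=
    hspan ▸ Submodule.mem_top
  have hle : Submodule.span k (Set.range fun i : Fin (Module.finrank k L) => y ^ (i : ℕ)) ≤
      Subalgebra.toSubmodule k⟮y⟯.toSubalgebra := by
    rw [Submodule.span_le]
    rintro _ ⟨i, rfl⟩
    exact pow_mem (mem_adjoin_simple_self k y) _
  exact hle hz

open Polynomial IntermediateField Topology in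
theorem exists_adjoin_simple_eq_top_of_dense {k L : Type*} [NontriviallyNormedField k]
    [CompleteSpace k] [Field L] [Algebra k L] [FiniteDimensional k L]
    {D : Set k} (hD : Dense D) {x : L} (hx : k⟮x⟯ = ⊤) (hsep : IsSeparable k x) :
    ∃ y : L, k⟮y⟯ = ⊤ ∧ ∃ (d : ℕ) (e : Fin d → k), (∀ i, e i ∈ D) ∧
      aeval y (X ^ d + ∑ i, C (e i) * X ^ (i : ℕ)) = 0 := by
  let f := Algebra.leftMulMatrix (Module.finBasis k L)
  let : NormedRing (Matrix (Fin (Module.finrank k L)) (Fin (Module.finrank k L)) k) :=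
    Matrix.linftyOpNormedRing
  let : NormedAlgebra k (Matrix (Fin (Module.finrank k L)) (Fin (Module.finrank k L)) k) :=
    Matrix.linftyOpNormedAlgebra
  let : NormedCommRing L := NormedCommRing.induced L _ f (Algebra.leftMulMatrix_injective _)
  let : NormedAlgebra k L := NormedAlgebra.induced k L _ f
  have : CompleteSpace L := FiniteDimensional.complete k L
  have hdeg := (Field.primitive_element_iff_minpoly_natDegree_eq k x).1 hx
  have hP : minpoly k x = X ^ (minpoly k x).natDegree +
      ∑ i : Fin (minpoly k x).natDegree, C ((minpoly k x).coeff i) * X ^ (i : ℕ) := by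
    conv_lhs => rw [(minpoly.monic (Algebra.IsIntegral.isIntegral x)).as_sum]
    rw [Finset.sum_range]
  have hlin : LinearIndependent k fun i : Fin (Module.finrank k L) => x ^ (i : ℕ) := by
    rw [← hdeg]
    exact linearIndependent_pow x
  have hU : {y : L | LinearIndependent k fun i : Fin (Module.finrank k L) => y ^ (i : ℕ)} ∈ 𝓝 x :=
    (isOpen_setOfPred_linearIndependent.preimage
      (f := fun (y : L) (i : Fin (Module.finrank k L)) => y ^ (i : ℕ))
      (by fun_prop)).mem_nhds hlin
  obtain ⟨y, hy, e, he, hroot⟩ := exists_root_mem_nhds_of_dense hD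
    (c := fun i : Fin (minpoly k x).natDegree => (minpoly k x).coeff i) (x := x)
    (by rw [← hP]; exact minpoly.aeval k x)
    (by rw [← hP]; exact (hsep.aeval_derivative_ne_zero (minpoly.aeval k x)).isUnit) hU
  exact ⟨y, adjoin_simple_eq_top_of_linearIndependent hy, _, e, he, hroot⟩

open Polynomial IntermediateField in
theorem IsSeparable.mem_adjoin_isAlgebraic_of_dense {k K : Type*} [NontriviallyNormedField k]
    [CompleteSpace k] [Field K] [Algebra k K] {F : Subfield k} (hF : Dense (F : Set k)) {x : K}
    (hsep : IsSeparable k x) : x ∈ adjoin k {y : K | IsAlgebraic F y} := by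
  have hint : IsIntegral k x := hsep.isIntegral
  have : FiniteDimensional k k⟮x⟯ := adjoin.finiteDimensional hint
  obtain ⟨y, hy, d, e, he, hroot⟩ := exists_adjoin_simple_eq_top_of_dense hF
    (x := AdjoinSimple.gen k x) (by
      rw [Field.primitive_element_iff_minpoly_natDegree_eq, minpoly_gen, adjoin.finrank hint]) (by
      rwa [IsSeparable, minpoly_gen])
  have hyalg : IsAlgebraic F (y : K) := by
    refine ⟨X ^ d + ∑ i, C (⟨e i, he i⟩ : F) * X ^ (i : ℕ), ?_, ?_⟩
    · refine (monic_X_pow_add ?_).ne_zero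
      exact (degree_sum_fin_lt _).trans_eq' rfl
    · have h := congrArg (algebraMap k⟮x⟯ K) hroot
      simp only [map_add, map_sum, map_mul, map_pow, aeval_X, aeval_C, map_zero,
        ← IsScalarTower.algebraMap_apply] at h ⊢
      exact h
  have hle : k⟮(y : K)⟯ ≤ adjoin k {y : K | IsAlgebraic F y} :=
    adjoin_simple_le_iff.2 (subset_adjoin _ _ hyalg)
  refine hle ?_
  have : (AdjoinSimple.gen k x) ∈ k⟮y⟯ := hy ▸ mem_top
  have := (lift_adjoin_simple k _ y) ▸ (mem_lift (AdjoinSimple.gen k x)).2 this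
  simpa using this

/-- A locally compact field is finite over the image of Frobenius. -/
theorem exists_finset_sum_pow_mul_of_charP (k : Type*) [NontriviallyNormedField k]
    [LocallyCompactSpace k] (p : ℕ) [Fact p.Prime] [CharP k p] :
    ∃ B : Finset k, ∀ a : k, ∃ c : k → k, a = ∑ b ∈ B, c b ^ p * b := by
  have : ProperSpace k := .of_locallyCompactSpace k
  have hp := (Fact.out : p.Prime)
  let F : Subfield k := (frobenius k p).fieldRange
  let : NontriviallyNormedField F :=
    { (inferInstance : NormedField F) with
      non_trivial := by
        obtain ⟨x, hx⟩ := NormedField.exists_one_lt_norm k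
        exact ⟨⟨x ^ p, x, rfl⟩, by
          simpa using one_lt_pow₀ hx hp.ne_zero⟩ }
  have hclosed : IsClosed (F : Set k) := by
    have hcont : Continuous fun x : k => x ^ p := continuous_pow p
    refine (isProperMap_iff_tendsto_cocompact.2 ⟨hcont, ?_⟩).isClosedMap.isClosed_range
    rw [← Metric.cobounded_eq_cocompact, ← tendsto_norm_atTop_iff_cobounded]
    simp only [norm_pow]
    exact (Filter.tendsto_pow_atTop hp.ne_zero).comp tendsto_norm_cobounded_atTop
  have : CompleteSpace F := hclosed.completeSpace_coe
  have : FiniteDimensional F k := .of_locallyCompactSpace F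
  obtain ⟨B, hB⟩ := Module.finite_def.1 this
  refine ⟨B, fun a => ?_⟩
  have ha : a ∈ Submodule.span F (B : Set k) := hB ▸ Submodule.mem_top
  obtain ⟨c, -, hc⟩ := Submodule.mem_span_finset.1 ha
  choose r hr using fun b => (c b).2
  refine ⟨r, hc.symm.trans (Finset.sum_congr rfl fun b _ => ?_)⟩
  have h : (c b : k) = r b ^ p := (hr b).symm
  rw [Subfield.smul_def, h, smul_eq_mul]

theorem exists_finset_sum_pow_mul (k : Type*) [NontriviallyNormedField k]
    [LocallyCompactSpace k] (p : ℕ) [ExpChar k p] :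
    ∃ B : Finset k, ∀ a : k, ∃ c : k → k, a = ∑ b ∈ B, c b ^ p * b := by
  rcases ‹ExpChar k p› with _ | hp
  · exact ⟨{1}, fun a => ⟨fun _ => a, by simp⟩⟩
  · have : Fact p.Prime := ⟨hp⟩
    exact exists_finset_sum_pow_mul_of_charP k p

theorem Subfield.countable_closure {k : Type*} [Field k] {s : Set k} (hs : s.Countable) :
    Countable (closure s) := by
  rw [← Cardinal.mk_le_aleph0_iff]
  exact (cardinalMk_closure_le_max s).trans (max_le hs.le_aleph0 le_rfl)

/-- If every element of `S` and of `k` has a `p`-th root in `k(S)`, then so does every element of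
`k(S)`. -/
theorem IntermediateField.exists_pow_eq_of_mem_adjoin {k K : Type*} [Field k] [Field K]
    [Algebra k K] (p : ℕ) [ExpChar K p] {S : Set K}
    (hS : ∀ x ∈ S, ∃ y ∈ adjoin k S, y ^ p = x)
    (hk : ∀ a : k, ∃ y ∈ adjoin k S, y ^ p = algebraMap k K a) {x : K} (hx : x ∈ adjoin k S) :
    ∃ y ∈ adjoin k S, y ^ p = x := by
  have hle : (adjoin k S).toSubfield ≤ (adjoin k S).toSubfield.map (frobenius K p) := by
    conv_lhs => rw [adjoin_toSubfield]
    rw [Subfield.closure_le]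
    rintro _ (⟨a, rfl⟩ | hx)
    · exact hk a
    · exact hS _ hx
  exact hle hx

open IntermediateField in
/-- An algebraic closure of a locally compact field is countably generated. -/
theorem exists_countable_adjoin_eq_top (k K : Type*) [NontriviallyNormedField k]
    [LocallyCompactSpace k] [Field K] [Algebra k K] [IsAlgClosure k K] :
    ∃ S : Set K, S.Countable ∧ adjoin k S = ⊤ := by
  have : ProperSpace k := .of_locallyCompactSpace k
  have : IsAlgClosed K := IsAlgClosure.isAlgClosed k
  have : Algebra.IsAlgebraic k K := IsAlgClosure.isAlgebraic
  obtain ⟨p, hpk⟩ := ExpChar.exists k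
  have hpK : ExpChar K p := expChar_of_injective_algebraMap (algebraMap k K).injective p
  have hp : 0 < p := expChar_pos k p
  obtain ⟨B, hB⟩ := exists_finset_sum_pow_mul k p
  obtain ⟨D, hDc, hDd⟩ := TopologicalSpace.exists_countable_dense k
  let F : Subfield k := Subfield.closure (D ∪ B)
  have hsub : D ∪ B ⊆ (F : Set k) := Subfield.subset_closure
  have hF : Dense (F : Set k) := hDd.mono (Set.subset_union_left.trans hsub)
  have : Countable F := Subfield.countable_closure (hDc.union B.countable_toSet)
  let S : Set K := {y | IsAlgebraic F y}
  refine ⟨S, Algebraic.countable F K, eq_top_iff.2 fun x _ => ?_⟩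
  have hroot : ∀ x ∈ S, ∃ y ∈ S, y ^ p = x := by
    intro x hx
    obtain ⟨y, rfl⟩ := IsAlgClosed.exists_pow_nat_eq x hp
    exact ⟨y, IsAlgebraic.of_pow hp hx, rfl⟩
  have hperf : ∀ x ∈ adjoin k S, ∃ y ∈ adjoin k S, y ^ p = x := by
    intro x hx
    refine exists_pow_eq_of_mem_adjoin p (fun x hx => ?_) (fun a => ?_) hx
    · obtain ⟨y, hy, h⟩ := hroot x hx
      exact ⟨y, subset_adjoin k S hy, h⟩
    · obtain ⟨c, rfl⟩ := hB a
      have hb : ∀ b ∈ B, ∃ y ∈ S, y ^ p = algebraMap k K b := fun b hb =>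
        hroot _ (isAlgebraic_algebraMap (⟨b, hsub (Or.inr hb)⟩ : F))
      choose! r hrS hr using hb
      refine ⟨∑ b ∈ B, algebraMap k K (c b) * r b, sum_mem fun b hb =>
        mul_mem (IntermediateField.algebraMap_mem _ _) (subset_adjoin k S (hrS b hb)), ?_⟩
      rw [sum_pow_char, map_sum]
      refine Finset.sum_congr rfl fun b hb => ?_
      rw [mul_pow, hr b hb, map_mul, map_pow]
  have : ExpChar (separableClosure k K) p :=
    expChar_of_injective_algebraMap (algebraMap k (separableClosure k K)).injective p
  obtain ⟨n, z, hz⟩ := IsPurelyInseparable.pow_mem (separableClosure k K) p x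
  have hxn : x ^ p ^ n ∈ adjoin k S := by
    rw [← hz]
    exact IsSeparable.mem_adjoin_isAlgebraic_of_dense hF (mem_separableClosure_iff.1 z.2)
  clear hz
  induction n with
  | zero => simpa using hxn
  | succ n ih =>
    refine ih ?_
    obtain ⟨y, hy, h⟩ := hperf _ hxn
    rw [pow_succ, pow_mul] at h
    exact frobenius_inj K p h ▸ hy

open IntermediateField in
theorem exists_countable_finiteDimensional_cover (k K : Type*) [NontriviallyNormedField k]
    [LocallyCompactSpace k] [Field K] [Algebra k K] [IsAlgClosure k K] :
    ∃ 𝓛 : Set (IntermediateField k K), 𝓛.Countable ∧ (∀ L ∈ 𝓛, FiniteDimensional k L) ∧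
      ∀ s : Finset K, ∃ L ∈ 𝓛, ∀ x ∈ s, x ∈ L := by
  classical
  have : Algebra.IsAlgebraic k K := IsAlgClosure.isAlgebraic
  obtain ⟨S, hS, hSK⟩ := exists_countable_adjoin_eq_top k K
  have hc : {T : Finset K | (T : Set K) ⊆ S}.Countable :=
    ((Set.countable_ofPred_finite_subset hS).preimage_of_injOn
      (f := ((↑) : Finset K → Set K)) Finset.coe_injective.injOn).mono
      fun T (hT : (T : Set K) ⊆ S) => show _ ∧ _ from ⟨T.finite_toSet, hT⟩
  refine ⟨(fun T : Finset K => adjoin k (T : Set K)) '' {T | (T : Set K) ⊆ S}, hc.image _, ?_, ?_⟩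
  · rintro _ ⟨T, -, rfl⟩
    exact finiteDimensional_adjoin fun x _ => Algebra.IsIntegral.isIntegral x
  · intro s
    have h : ∀ x : K, ∃ T : Finset K, (T : Set K) ⊆ S ∧ x ∈ adjoin k (T : Set K) := fun x =>
      exists_finset_of_mem_adjoin (hSK ▸ mem_top)
    choose T hTS hT using h
    refine ⟨_, ⟨s.biUnion T, by simpa using fun x _ => hTS x, rfl⟩, fun x hx => ?_⟩
    exact adjoin.mono _ _ _ (by exact_mod_cast Finset.subset_biUnion_of_mem T hx) (hT x)

open MvPolynomial

/-- Let `k` be a local field, `K` an algebraic closure of `k`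
and `M ⊆ K^n` the common zero set of a family of polynomials.  If `M(k')` is
countable for every finite extension `k'` of `k` inside `K`, then `M` is
finite. -/
theorem stmt14 {k : Type*} [NontriviallyNormedField k] [LocallyCompactSpace k]
    {K : Type*} [Field K] [Algebra k K] [IsAlgClosure k K]
    {n : ℕ} {ι : Type*} (Q : ι → MvPolynomial (Fin n) K)
    (M : Set (Fin n → K)) (hM : M = {x : Fin n → K | ∀ i, eval x (Q i) = 0})
    (hcount : ∀ L : IntermediateField k K, FiniteDimensional k L →
      {x ∈ M | ∀ j, x j ∈ L}.Countable) :
    M.Finite := by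
  have : ProperSpace k := .of_locallyCompactSpace k
  have : IsAlgClosed K := IsAlgClosure.isAlgClosed k
  obtain ⟨𝓛, h𝓛c, h𝓛f, h𝓛⟩ := exists_countable_finiteDimensional_cover k K
  have hMc : M.Countable := by
    refine (h𝓛c.biUnion fun L hL => hcount L (h𝓛f L hL)).mono fun x hx => ?_
    obtain ⟨L, hL, hxL⟩ := h𝓛 ((Set.finite_range x).toFinset)
    exact Set.mem_biUnion hL ⟨hx, fun j => hxL _ (by simp)⟩
  by_contra hinf
  have hMI : M = {x | ∀ p ∈ Ideal.span (Set.range Q), eval x p = 0} := by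
    ext x
    have h : Ideal.span (Set.range Q) ≤ RingHom.ker (eval x) ↔ ∀ i, eval x (Q i) = 0 := by
      rw [Ideal.span_le, Set.range_subset_iff]
      rfl
    rw [hM]
    exact h.symm
  rw [hMI] at hinf hMc
  obtain ⟨G, hG⟩ := exists_eval_surjOn_of_infinite hinf
  have hK : (Set.univ : Set K).Countable := (hMc.image _).mono hG
  have : Countable K := Set.countable_univ_iff.1 hK
  have : Countable k := (algebraMap k K).injective.countable
  exact Cardinal.aleph0_lt_continuum.not_ge <|
    (continuum_le_cardinal_of_nontriviallyNormedField k).trans (Cardinal.mk_le_aleph0 (α := k))
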